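/- Let |q| < 1, x, y ∈ S(q), |ρ| < 1. Then 1 / (Σ_{n≥0} (ρ^n/[n]_q!) H_n(x|q) H_n(y|q)) = (∏_{k=0}^{∞} ω(x√(1-q)/2, y√(1-q)/2 | ρ q^k)) / (ρ²;q)_∞ = Σ_{k=0}^{∞} (-1)^k q^{k(k-1)/2} (ρ^k/[k]_q!) Q_{k,k}(x,y|ρ,q), the series converging. -/

import Mathlib

open Finset MeasureTheory

noncomputable section

/-- [n]_q = 1 + q + ... + q^{n-1} -/
def qNat (q : ℝ) (n : ℕ) : ℝ := ∑ j ∈ Finset.range n, q ^ j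

/-- [n]_q! -/
def qFact (q : ℝ) : ℕ → ℝ
  | 0 => 1
  | n + 1 => qFact q n * qNat q (n + 1)

/-- q-binomial coefficient -/
def qBinom (q : ℝ) (n k : ℕ) : ℝ :=
  if k ≤ n then qFact q n / (qFact q (n - k) * qFact q k) else 0

/-- q-Pochhammer symbol (a;q)_n -/
def qPoch (a q : ℝ) (n : ℕ) : ℝ := ∏ j ∈ Finset.range n, (1 - a * q ^ j)

/-- q-Pochhammer symbol (a;q)_∞ -/
def qPochInf (a q : ℝ) : ℝ := ∏' j : ℕ, (1 - a * q ^ j)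

/-- continuous q-Hermite polynomials H_n(x|q) -/
def qHermite (q : ℝ) : ℕ → ℝ → ℝ
  | 0, _ => 1
  | 1, x => x
  | n + 2, x => x * qHermite q (n + 1) x - qNat q (n + 1) * qHermite q n x

/-- big q-Hermite polynomials H_n(x|a,q) -/
def bigqHermite (q a : ℝ) : ℕ → ℝ → ℝ
  | 0, _ => 1
  | 1, x => x - a
  | n + 2, x => (x - a * q ^ (n + 1)) * bigqHermite q a (n + 1) x -
      qNat q (n + 1) * bigqHermite q a n x

/-- rescaled Al-Salam--Chihara polynomials P_n(x|y,ρ,q) -/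
def ascP (q y ρ : ℝ) : ℕ → ℝ → ℝ
  | 0, _ => 1
  | 1, x => x - ρ * y
  | n + 2, x => (x - ρ * y * q ^ (n + 1)) * ascP q y ρ (n + 1) x -
      qNat q (n + 1) * (1 - ρ ^ 2 * q ^ n) * ascP q y ρ n x

/-- generating function φ_H(x|t,q) of the q-Hermite polynomials -/
def phiH (q t x : ℝ) : ℝ := ∑' n : ℕ, t ^ n / qFact q n * qHermite q n x

/-- γ_{i,j}(x,y|ρ,q) -/
def gammaPM (q ρ : ℝ) (i j : ℕ) (x y : ℝ) : ℝ :=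
  ∑' n : ℕ, ρ ^ n / qFact q n * qHermite q (n + i) x * qHermite q (n + j) y

/-- the polynomials Q_{i,j}(x,y|ρ,q) -/
def Qpoly (q ρ : ℝ) (i j : ℕ) (x y : ℝ) : ℝ :=
  ∑ s ∈ Finset.range (j + 1),
    (-1 : ℝ) ^ s * q ^ (s * (s - 1) / 2) * qBinom q j s * ρ ^ s * qHermite q (j - s) y *
      ascP q y ρ (i + s) x / qPoch (ρ ^ 2) q (i + s)

/-- the interval S(q) = [-2/√(1-q), 2/√(1-q)] -/
def Sq (q : ℝ) : Set ℝ := Set.Icc (-(2 / Real.sqrt (1 - q))) (2 / Real.sqrt (1 - q))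

/-- ω(x,y|ρ) -/
def omegaPM (x y ρ : ℝ) : ℝ :=
  (1 - ρ ^ 2) ^ 2 - 4 * ρ * (1 + ρ ^ 2) * x * y + 4 * ρ ^ 2 * (x ^ 2 + y ^ 2)

/-- l(x|a) -/
def lPM (x a : ℝ) : ℝ := (1 + a) ^ 2 - 4 * a * x ^ 2

/-- the q-Normal density f_N(x|q) -/
def fN (q x : ℝ) : ℝ :=
  Real.sqrt ((1 - q) * (4 - (1 - q) * x ^ 2)) * qPochInf q q / (2 * Real.pi) *
    ∏' j : ℕ, lPM (x * Real.sqrt (1 - q) / 2) (q ^ (j + 1))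

/-- the (q,ρ)-Conditional Normal density f_CN(x|y,ρ,q) -/
def fCN (q ρ x y : ℝ) : ℝ :=
  fN q x * qPochInf (ρ ^ 2) q /
    ∏' j : ℕ, omegaPM (x * Real.sqrt (1 - q) / 2) (y * Real.sqrt (1 - q) / 2) (ρ * q ^ j)

/-- the (ρ,q)-bivariate Normal density f_{2D}(x,y|ρ,q) -/
def f2D (q ρ x y : ℝ) : ℝ := fCN q ρ x y * fN q y

open Filter Topology

lemma qNat_zero (q : ℝ) : qNat q 0 = 0 := by simp [qNat]

lemma qNat_one (q : ℝ) : qNat q 1 = 1 := by simp [qNat]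

lemma qNat_add (q : ℝ) (m n : ℕ) : qNat q (m + n) = qNat q m + q ^ m * qNat q n := by
  simp only [qNat, Finset.sum_range_add, Finset.mul_sum, pow_add]

lemma one_sub_mul_qNat (q : ℝ) (n : ℕ) : (1 - q) * qNat q n = 1 - q ^ n :=
  mul_neg_geom_sum q n

lemma one_sub_pow_succ_pos {q : ℝ} (hq : |q| < 1) (n : ℕ) : 0 < 1 - q ^ (n + 1) := by
  have h : |q ^ (n + 1)| < 1 := by
    rw [abs_pow]
    exact pow_lt_one₀ (abs_nonneg q) hq n.succ_ne_zero
  linarith [(abs_lt.mp h).2]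

lemma qNat_succ_pos {q : ℝ} (hq : |q| < 1) (n : ℕ) : 0 < qNat q (n + 1) := by
  have h := one_sub_mul_qNat q (n + 1)
  have h1 : 0 < 1 - q := by linarith [(abs_lt.mp hq).2]
  exact pos_of_mul_pos_right (h ▸ one_sub_pow_succ_pos hq n) h1.le

lemma qFact_pos {q : ℝ} (hq : |q| < 1) (n : ℕ) : 0 < qFact q n := by
  induction n with
  | zero => simp [qFact]
  | succ n ih => exact mul_pos ih (qNat_succ_pos hq n)

lemma qHermite_succ (q : ℝ) (n : ℕ) (x : ℝ) :
    qHermite q (n + 1) x = x * qHermite q n x - qNat q n * qHermite q (n - 1) x := by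
  cases n with
  | zero => simp [qHermite, qNat_zero]
  | succ n => rfl

/-! ### Identities for sums over antidiagonals -/

lemma qNat_mul_sum_antidiagonal (q : ℝ) (n : ℕ) (F : ℕ × ℕ → ℝ) :
    qNat q (n + 1) * ∑ p ∈ antidiagonal (n + 1), F p =
      ∑ p ∈ antidiagonal n, qNat q (p.2 + 1) * F (p.1, p.2 + 1) +
        ∑ p ∈ antidiagonal n, q ^ p.2 * qNat q (p.1 + 1) * F (p.1 + 1, p.2) := by
  have h : ∀ p ∈ antidiagonal (n + 1), qNat q (n + 1) * F p =
      qNat q p.2 * F p + q ^ p.2 * qNat q p.1 * F p := by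
    intro p hp
    rw [← mem_antidiagonal.mp hp, add_comm p.1, qNat_add]
    ring
  rw [Finset.mul_sum, Finset.sum_congr rfl h, Finset.sum_add_distrib,
    Finset.Nat.sum_antidiagonal_succ',
    Finset.Nat.sum_antidiagonal_succ (f := fun p ↦ q ^ p.2 * qNat q p.1 * F p)]
  simp [qNat_zero]

/-- The coefficients of the `q`-exponential function `(t;q)_∞`. -/
def qExpCoeff (q : ℝ) (s : ℕ) : ℝ := (-1) ^ s * q ^ (s * (s - 1) / 2) / qFact q s

lemma qNat_mul_qExpCoeff_succ {q : ℝ} (hq : |q| < 1) (s : ℕ) :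
    qNat q (s + 1) * qExpCoeff q (s + 1) = -(q ^ s * qExpCoeff q s) := by
  have h1 := (qFact_pos hq s).ne'
  have h2 := (qNat_succ_pos hq s).ne'
  simp only [qExpCoeff, qFact, Nat.triangle_succ]
  field_simp
  ring

lemma sum_antidiagonal_qExpCoeff {q : ℝ} (hq : |q| < 1) (n : ℕ) :
    ∑ p ∈ antidiagonal (n + 1), qExpCoeff q p.1 / qFact q p.2 = 0 := by
  have key : ∀ m, qNat q (m + 1) * ∑ p ∈ antidiagonal (m + 1), qExpCoeff q p.1 / qFact q p.2 =
      (1 - q ^ m) * ∑ p ∈ antidiagonal m, qExpCoeff q p.1 / qFact q p.2 := by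
    intro m
    rw [qNat_mul_sum_antidiagonal, ← Finset.sum_add_distrib, Finset.mul_sum]
    refine Finset.sum_congr rfl fun p hp ↦ ?_
    have h1 := (qFact_pos hq p.2).ne'
    have h2 := (qNat_succ_pos hq p.2).ne'
    have h3 := qNat_mul_qExpCoeff_succ hq p.1
    have h4 : q ^ m = q ^ p.2 * q ^ p.1 := by
      rw [← pow_add, add_comm, mem_antidiagonal.mp hp]
    calc _ = qNat q (p.2 + 1) * (qExpCoeff q p.1 / (qFact q p.2 * qNat q (p.2 + 1))) +
          q ^ p.2 * (qNat q (p.1 + 1) * qExpCoeff q (p.1 + 1)) / qFact q p.2 := by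
            simp only [qFact]; ring
      _ = _ := by
        rw [h3, h4]
        field_simp
        ring
  have h2 := (qNat_succ_pos hq n).ne'
  induction n with
  | zero => simpa [h2] using key 0
  | succ n ih =>
    have := key (n + 1)
    rw [ih (qNat_succ_pos hq n).ne', mul_zero] at this
    exact (mul_eq_zero.mp this).resolve_left h2

/-- Solution of the recurrence in the second index satisfied by the functions `γ_{i,j}`. -/
lemma eq_sum_antidiagonal_of_recurrence {q : ℝ} (hq : |q| < 1) (ρ y : ℝ) (g : ℕ → ℕ → ℝ)
    (hg : ∀ i j, g i (j + 1) =
      y * g i j - qNat q j * g i (j - 1) - q ^ j * ρ * g (i + 1) j) (i j : ℕ) :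
    g i j = qFact q j * ∑ p ∈ antidiagonal j,
      qExpCoeff q p.1 * ρ ^ p.1 * (qHermite q p.2 y / qFact q p.2) * g (i + p.1) 0 := by
  set T : ℕ → ℕ → ℝ := fun i j ↦ ∑ p ∈ antidiagonal j,
      qExpCoeff q p.1 * ρ ^ p.1 * (qHermite q p.2 y / qFact q p.2) * g (i + p.1) 0 with hT
  have hlow : ∀ i j, ∑ p ∈ antidiagonal j, qExpCoeff q p.1 * ρ ^ p.1 *
      (qNat q p.2 * qHermite q (p.2 - 1) y / qFact q p.2) * g (i + p.1) 0 =
      if j = 0 then 0 else T i (j - 1) := by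
    intro i j
    cases j with
    | zero => simp [qNat_zero]
    | succ j =>
      rw [Finset.Nat.sum_antidiagonal_succ']
      simp only [qNat_zero, hT, Nat.add_sub_cancel, Nat.succ_ne_zero, if_false, zero_mul,
        zero_div, mul_zero, zero_add]
      refine Finset.sum_congr rfl fun p _ ↦ ?_
      have h1 := (qFact_pos hq p.2).ne'
      have h2 := (qNat_succ_pos hq p.2).ne'
      simp only [qFact]
      field_simp
  have hrec : ∀ i j, qNat q (j + 1) * T i (j + 1) =
      y * T i j - (if j = 0 then 0 else T i (j - 1)) - q ^ j * ρ * T (i + 1) j := by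
    intro i j
    rw [← hlow, hT]
    simp only
    rw [qNat_mul_sum_antidiagonal, Finset.mul_sum, Finset.mul_sum, ← Finset.sum_sub_distrib,
      ← Finset.sum_sub_distrib, ← Finset.sum_add_distrib]
    refine Finset.sum_congr rfl fun p hp ↦ ?_
    have h1 := (qFact_pos hq p.2).ne'
    have h2 := (qNat_succ_pos hq p.2).ne'
    have h3 := qNat_mul_qExpCoeff_succ hq p.1
    have h4 : q ^ j = q ^ p.2 * q ^ p.1 := by
      rw [← pow_add, add_comm, mem_antidiagonal.mp hp]
    have h5 : i + (p.1 + 1) = i + 1 + p.1 := by ring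
    have h6 := qHermite_succ q p.2 y
    calc _ = qExpCoeff q p.1 * ρ ^ p.1 * (qNat q (p.2 + 1) * qHermite q (p.2 + 1) y /
            (qFact q p.2 * qNat q (p.2 + 1))) * g (i + p.1) 0 +
          q ^ p.2 * (qNat q (p.1 + 1) * qExpCoeff q (p.1 + 1)) * ρ ^ (p.1 + 1) *
            (qHermite q p.2 y / qFact q p.2) * g (i + 1 + p.1) 0 := by
            simp only [qFact, h5]; ring
      _ = _ := by
        rw [h3, h4, h6]
        field_simp
        ring
  have main : ∀ j, (∀ i, g i j = qFact q j * T i j) ∧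
      ∀ i, g i (j + 1) = qFact q (j + 1) * T i (j + 1) := by
    intro j
    induction j with
    | zero =>
      have h0 : ∀ i, g i 0 = qFact q 0 * T i 0 := by
        intro i
        simp [hT, qFact, qExpCoeff, qHermite]
      refine ⟨h0, fun i ↦ ?_⟩
      have h := hrec i 0
      simp only [qFact] at h0 ⊢
      rw [hg, one_mul, h, h0 i, h0 (i + 1)]
      simp [qNat_zero]
    | succ j ih =>
      refine ⟨ih.2, fun i ↦ ?_⟩
      have h := hrec i (j + 1)
      rw [show qFact q (j + 1 + 1) = qFact q (j + 1) * qNat q (j + 1 + 1) from rfl, mul_assoc,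
        h, hg, ih.2, ih.2, Nat.add_sub_cancel, ih.1]
      simp only [qFact, Nat.succ_ne_zero, if_false]
      ring
  exact (main j).1 i

/-! ### Growth of the `q`-Hermite polynomials -/

lemma prod_one_add_le_exp_tsum {f : ℕ → ℝ} (hf : ∀ n, 0 ≤ f n) (hs : Summable f) (n : ℕ) :
    ∏ k ∈ Finset.range n, (1 + f k) ≤ Real.exp (∑' k, f k) :=
  (Real.prod_one_add_le_exp_sum _ hf).trans
    (Real.exp_le_exp.mpr (hs.sum_le_tsum _ fun k _ ↦ hf k))

/-- A solution of a summable perturbation of the Chebyshev recurrence grows at most linearly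
on `[-2, 2]`. -/
lemma abs_le_of_perturbed_chebyshev {t : ℝ} (ht : |t| ≤ 2) {c h : ℕ → ℝ} (h0 : h 0 = 1)
    (h1 : h 1 = t) (hrec : ∀ n, h (n + 2) = t * h (n + 1) - (1 - c n) * h n) (n : ℕ) :
    |h n| ≤ (n + 1) * ∏ k ∈ Finset.range n, (1 + (k + 1) * |c k|) := by
  set p : ℕ → ℝ := fun n ↦ ∏ k ∈ Finset.range n, (1 + (k + 1) * |c k|) with hp
  have hp0 : p 0 = 1 := by simp [hp]
  have hps : ∀ n : ℕ, p (n + 1) = p n * (1 + (n + 1) * |c n|) := fun n ↦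
    Finset.prod_range_succ _ _
  have hpos : ∀ n, 0 ≤ p n := fun n ↦ Finset.prod_nonneg fun k _ ↦ by positivity
  have hmono : ∀ n, p n ≤ p (n + 1) := fun n ↦ by
    rw [hps]
    exact le_mul_of_one_le_right (hpos n) (le_add_of_nonneg_right (by positivity))
  set z : ℂ := ⟨t / 2, Real.sqrt (1 - (t / 2) ^ 2)⟩ with hz
  set w : ℂ := ⟨t / 2, -Real.sqrt (1 - (t / 2) ^ 2)⟩ with hw
  have hsq : Real.sqrt (1 - (t / 2) ^ 2) * Real.sqrt (1 - (t / 2) ^ 2) = 1 - (t / 2) ^ 2 :=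
    Real.mul_self_sqrt (by nlinarith [abs_le.mp ht])
  have hzw : z * w = 1 := by
    apply Complex.ext <;> simp [hz, hw]
    · linarith
    · ring
  have hadd : z + w = t := by
    apply Complex.ext <;> simp [hz, hw]
  have hnz : ‖z‖ = 1 := by
    rw [Complex.norm_def, Complex.normSq_mk, hsq]
    ring_nf
    simp
  have hnw : ‖w‖ = 1 := by
    rw [Complex.norm_def, Complex.normSq_mk, neg_mul_neg, hsq]
    ring_nf
    simp
  have main : ∀ n : ℕ, |h n| ≤ (n + 1) * p n ∧
      ‖(h (n + 1) : ℂ) - z * h n‖ ≤ p n := by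
    intro n
    induction n with
    | zero =>
      refine ⟨by simp [h0, hp0], ?_⟩
      rw [h0, h1, ← hadd, hp0]
      simp [hnw]
    | succ n ih =>
      obtain ⟨ih1, ih2⟩ := ih
      constructor
      · have e : (h (n + 1) : ℂ) = z * h n + (h (n + 1) - z * h n) := by ring
        have : |h (n + 1)| ≤ |h n| + ‖(h (n + 1) : ℂ) - z * h n‖ := by
          have hr : ∀ a : ℝ, |a| = ‖(a : ℂ)‖ := fun a ↦ by simp
          rw [hr, hr]
          calc ‖(h (n + 1) : ℂ)‖ = ‖z * h n + (h (n + 1) - z * h n)‖ := by rw [← e]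
            _ ≤ ‖z * h n‖ + _ := norm_add_le _ _
            _ = _ := by rw [norm_mul, hnz, one_mul]
        have h3 : ((n : ℝ) + 1 + 1) * p n ≤ ((n : ℝ) + 1 + 1) * p (n + 1) :=
          mul_le_mul_of_nonneg_left (hmono n) (by positivity)
        push_cast
        linarith
      · have e : (h (n + 1 + 1) : ℂ) - z * h (n + 1) =
            w * (h (n + 1) - z * h n) + c n * h n := by
          rw [hrec n]
          push_cast
          rw [← hadd]
          linear_combination (h n : ℂ) * hzw
        rw [e]
        refine (norm_add_le _ _).trans ?_
        rw [norm_mul, norm_mul, hnw, one_mul, Complex.norm_real, Complex.norm_real, hps]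
        have := mul_le_mul_of_nonneg_left ih1 (abs_nonneg (c n))
        simp only [Real.norm_eq_abs]
        linarith
  exact (main n).1

lemma exists_abs_sqrt_pow_mul_qHermite_le {q : ℝ} (hq : |q| < 1) :
    ∃ C, ∀ x ∈ Sq q, ∀ n : ℕ, |Real.sqrt (1 - q) ^ n * qHermite q n x| ≤ C * (n + 1) := by
  have h1 : 0 < 1 - q := by linarith [(abs_lt.mp hq).2]
  have hs : 0 < Real.sqrt (1 - q) := Real.sqrt_pos.mpr h1
  have hss : Real.sqrt (1 - q) ^ 2 = 1 - q := Real.sq_sqrt h1.le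
  have hsum : Summable fun k : ℕ ↦ ((k : ℝ) + 1) * |q ^ (k + 1)| := by
    have := (summable_nat_add_iff 1).mpr
      (summable_pow_mul_geometric_of_norm_lt_one (R := ℝ) 1 (r := |q|) (by simpa using hq))
    simpa [abs_pow] using this
  refine ⟨Real.exp (∑' k : ℕ, ((k : ℝ) + 1) * |q ^ (k + 1)|), fun x hx n ↦ ?_⟩
  have ht : |Real.sqrt (1 - q) * x| ≤ 2 := by
    rw [abs_mul, abs_of_pos hs, mul_comm, ← le_div_iff₀ hs]
    exact abs_le.mpr hx
  have := abs_le_of_perturbed_chebyshev ht (c := fun k ↦ q ^ (k + 1))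
    (h := fun n ↦ Real.sqrt (1 - q) ^ n * qHermite q n x) (by simp [qHermite])
    (by simp [qHermite]) (fun m ↦ by
      have e : 1 - q ^ (m + 1) = Real.sqrt (1 - q) ^ 2 * qNat q (m + 1) := by
        rw [hss, one_sub_mul_qNat]
      simp only [e, qHermite]
      ring) n
  refine this.trans ?_
  rw [mul_comm]
  exact mul_le_mul_of_nonneg_right
    (prod_one_add_le_exp_tsum (fun k ↦ by positivity) hsum n) (by positivity)

lemma exists_inv_qFact_le {q : ℝ} (hq : |q| < 1) :
    ∃ D, ∀ n : ℕ, 1 / qFact q n ≤ D * (1 - q) ^ n := by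
  have h1 : 0 < 1 - q := by linarith [(abs_lt.mp hq).2]
  have h2 : 0 < 1 - |q| := by linarith
  have hsum : Summable fun k : ℕ ↦ |q| ^ (k + 1) / (1 - |q|) :=
    ((summable_nat_add_iff 1).mpr
      (summable_geometric_of_lt_one (abs_nonneg q) hq)).div_const _
  refine ⟨Real.exp (∑' k : ℕ, |q| ^ (k + 1) / (1 - |q|)), fun n ↦ ?_⟩
  have key : 1 / qFact q n ≤
      (∏ k ∈ Finset.range n, (1 + |q| ^ (k + 1) / (1 - |q|))) * (1 - q) ^ n := by
    induction n with
    | zero => simp [qFact]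
    | succ n ih =>
      have h3 := qNat_succ_pos hq n
      have h4 : 1 / qNat q (n + 1) ≤ (1 + |q| ^ (n + 1) / (1 - |q|)) * (1 - q) := by
        rw [div_le_iff₀ h3, mul_assoc, one_sub_mul_qNat]
        have h5 : q ^ (n + 1) ≤ |q| ^ (n + 1) := by
          rw [← abs_pow]; exact le_abs_self _
        have h6 : |q| ^ (n + 1) ≤ |q| := pow_le_of_le_one (abs_nonneg q) hq.le n.succ_ne_zero
        have h7 : 0 ≤ |q| ^ (n + 1) := by positivity
        calc (1 : ℝ) ≤ (1 + |q| ^ (n + 1) / (1 - |q|)) * (1 - |q| ^ (n + 1)) := by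
              rw [← sub_nonneg]
              have : (1 + |q| ^ (n + 1) / (1 - |q|)) * (1 - |q| ^ (n + 1)) - 1 =
                  |q| ^ (n + 1) * (|q| - |q| ^ (n + 1)) / (1 - |q|) := by
                field_simp
                ring
              rw [this]
              exact div_nonneg (mul_nonneg h7 (by linarith)) h2.le
          _ ≤ _ := mul_le_mul_of_nonneg_left (by linarith) (by positivity)
      rw [Finset.prod_range_succ, pow_succ (1 - q) n, show qFact q (n + 1) = qFact q n * qNat q (n + 1)
        from rfl, ← one_div_mul_one_div, mul_mul_mul_comm]
      exact mul_le_mul ih h4 (by positivity)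
        ((one_div_pos.mpr (qFact_pos hq n)).le.trans ih)
  exact key.trans (mul_le_mul_of_nonneg_right
    (prod_one_add_le_exp_tsum (fun k ↦ by positivity) hsum n) (by positivity))

/-- A bound for products of two `q`-Hermite polynomials on `S(q)`. -/
lemma exists_abs_qHermite_mul_le {q x y : ℝ} (hq : |q| < 1) (hx : x ∈ Sq q) (hy : y ∈ Sq q) :
    ∃ K, 0 ≤ K ∧ ∀ a b : ℕ, |qHermite q a x * qHermite q b y| ≤
      K * ((a + 1) * (b + 1)) / Real.sqrt (1 - q) ^ (a + b) := by
  have h1 : 0 < 1 - q := by linarith [(abs_lt.mp hq).2]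
  have hs : 0 < Real.sqrt (1 - q) := Real.sqrt_pos.mpr h1
  obtain ⟨C, hC⟩ := exists_abs_sqrt_pow_mul_qHermite_le hq
  refine ⟨C * C, mul_self_nonneg C, fun a b ↦ ?_⟩
  rw [le_div_iff₀ (by positivity)]
  have hA := hC x hx a
  have hB := hC y hy b
  calc _ = |Real.sqrt (1 - q) ^ a * qHermite q a x| * |Real.sqrt (1 - q) ^ b * qHermite q b y| := by
        rw [abs_mul, abs_mul, abs_mul, abs_pow, abs_pow, abs_of_pos hs]; ring
    _ ≤ (C * (a + 1)) * (C * (b + 1)) :=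
        mul_le_mul hA hB (abs_nonneg _) ((abs_nonneg _).trans hA)
    _ = _ := by ring

lemma summable_succ_sq_mul_pow {r : ℝ} (hr : |r| < 1) :
    Summable fun n : ℕ ↦ ((n : ℝ) + 1) ^ 2 * |r| ^ n := by
  have h : ‖|r|‖ < 1 := by simpa using hr
  have := (((summable_pow_mul_geometric_of_norm_lt_one 2 h).add
    ((summable_pow_mul_geometric_of_norm_lt_one 1 h).mul_left 2)).add
      (summable_pow_mul_geometric_of_norm_lt_one 0 h))
  refine this.congr fun n ↦ ?_
  ring

lemma summable_gammaPM {q ρ x y : ℝ} (hq : |q| < 1) (hρ : |ρ| < 1) (hx : x ∈ Sq q)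
    (hy : y ∈ Sq q) (i j : ℕ) :
    Summable fun n : ℕ ↦ ρ ^ n / qFact q n * qHermite q (n + i) x * qHermite q (n + j) y := by
  have h1 : 0 < 1 - q := by linarith [(abs_lt.mp hq).2]
  have hs : 0 < Real.sqrt (1 - q) := Real.sqrt_pos.mpr h1
  obtain ⟨K, hK0, hK⟩ := exists_abs_qHermite_mul_le hq hx hy
  obtain ⟨D, hD⟩ := exists_inv_qFact_le hq
  set s := Real.sqrt (1 - q) with hs_def
  have hss : s ^ 2 = 1 - q := Real.sq_sqrt h1.le
  refine Summable.of_norm_bounded (g := fun n : ℕ ↦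
    D * K * ((i + 1) * (j + 1)) / s ^ (i + j) * (((n : ℝ) + 1) ^ 2 * |ρ| ^ n))
    ((summable_succ_sq_mul_pow hρ).mul_left _) fun n ↦ ?_
  have hn := qFact_pos hq n
  have hDn : 0 ≤ D * (1 - q) ^ n := (one_div_pos.mpr hn).le.trans (hD n)
  have hD0 : 0 ≤ D := nonneg_of_mul_nonneg_left hDn (by positivity)
  calc _ = |ρ| ^ n * (1 / qFact q n) * |qHermite q (n + i) x * qHermite q (n + j) y| := by
        rw [Real.norm_eq_abs, mul_assoc, abs_mul, abs_div, abs_pow, abs_of_pos hn]; ring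
    _ ≤ |ρ| ^ n * (D * (1 - q) ^ n) *
        (K * (((n + i : ℕ) + 1) * ((n + j : ℕ) + 1)) / s ^ (n + i + (n + j))) := by
        gcongr
        · exact hD n
        · exact hK _ _
    _ = |ρ| ^ n * D * (K * ((n + i + 1) * (n + j + 1)) / s ^ (i + j)) := by
        have : s ^ (n + i + (n + j)) = (1 - q) ^ n * s ^ (i + j) := by
          rw [← hss]; ring
        rw [this]
        push_cast
        field_simp
    _ ≤ |ρ| ^ n * D * (K * (((n + 1) * (i + 1)) * ((n + 1) * (j + 1))) / s ^ (i + j)) := by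
        gcongr
        · nlinarith [mul_nonneg (n.cast_nonneg (α := ℝ)) (i.cast_nonneg (α := ℝ))]
        · nlinarith [mul_nonneg (n.cast_nonneg (α := ℝ)) (j.cast_nonneg (α := ℝ))]
    _ = _ := by ring

/-! ### Recurrences for the functions `γ_{i,j}` -/

lemma gammaPM_swap (q ρ : ℝ) (i j : ℕ) (x y : ℝ) :
    gammaPM q ρ i j x y = gammaPM q ρ j i y x :=
  tsum_congr fun _ ↦ mul_right_comm _ _ _

lemma gammaPM_succ_right {q ρ x y : ℝ} (hq : |q| < 1) (hρ : |ρ| < 1) (hx : x ∈ Sq q)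
    (hy : y ∈ Sq q) (i j : ℕ) :
    gammaPM q ρ i (j + 1) x y = y * gammaPM q ρ i j x y -
      qNat q j * gammaPM q ρ i (j - 1) x y - q ^ j * ρ * gammaPM q ρ (i + 1) j x y := by
  have hS := fun i j ↦ (summable_gammaPM hq hρ hx hy i j).hasSum
  have hA : HasSum (fun n : ℕ ↦ ρ ^ n / qFact q n * qNat q n * qHermite q (n + i) x *
      qHermite q (n + j - 1) y) (ρ * gammaPM q ρ (i + 1) j x y) := by
    have h := (hS (i + 1) j).mul_left ρ
    refine (hasSum_nat_add_iff' 1).mp ?_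
    simp only [Finset.sum_range_one, qNat_zero, mul_zero, zero_mul, sub_zero]
    refine h.congr_fun fun n ↦ ?_
    have h1 := (qFact_pos hq n).ne'
    have h2 := (qNat_succ_pos hq n).ne'
    rw [show n + 1 + i = n + (i + 1) by ring, show n + 1 + j - 1 = n + j by omega]
    simp only [qFact]
    field_simp
    ring
  have hB := (((hS i j).mul_left y).sub ((hS i (j - 1)).mul_left (qNat q j))).sub
    (hA.mul_left (q ^ j))
  rw [mul_assoc (q ^ j)]
  refine Eq.trans (tsum_congr fun n ↦ ?_) hB.tsum_eq
  rw [← add_assoc, qHermite_succ, add_comm n j, qNat_add]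
  cases j with
  | zero => simp only [qNat_zero]; ring
  | succ j =>
    rw [show j + 1 + n - 1 = n + j by omega, Nat.add_sub_cancel]
    ring

lemma gammaPM_succ_left {q ρ x y : ℝ} (hq : |q| < 1) (hρ : |ρ| < 1) (hx : x ∈ Sq q)
    (hy : y ∈ Sq q) (i j : ℕ) :
    gammaPM q ρ (i + 1) j x y = x * gammaPM q ρ i j x y -
      qNat q i * gammaPM q ρ (i - 1) j x y - q ^ i * ρ * gammaPM q ρ i (j + 1) x y := by
  rw [gammaPM_swap, gammaPM_succ_right hq hρ hy hx]
  simp only [gammaPM_swap q ρ _ _ y x]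

lemma gammaPM_succ_zero {q ρ x y : ℝ} (hq : |q| < 1) (hρ : |ρ| < 1) (hx : x ∈ Sq q)
    (hy : y ∈ Sq q) (i : ℕ) :
    (1 - ρ ^ 2 * q ^ i) * gammaPM q ρ (i + 1) 0 x y =
      (x - ρ * y * q ^ i) * gammaPM q ρ i 0 x y - qNat q i * gammaPM q ρ (i - 1) 0 x y := by
  have h1 := gammaPM_succ_left hq hρ hx hy i 0
  have h2 := gammaPM_succ_right hq hρ hx hy i 0
  rw [qNat_zero, pow_zero] at h2
  linear_combination h1 - q ^ i * ρ * h2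

lemma one_sub_sq_mul_pow_pos {q ρ : ℝ} (hq : |q| < 1) (hρ : |ρ| < 1) (n : ℕ) :
    0 < 1 - ρ ^ 2 * q ^ n := by
  have h : |ρ ^ 2 * q ^ n| < 1 := by
    rw [abs_mul, abs_pow, abs_pow]
    exact mul_lt_one_of_nonneg_of_lt_one_left (by positivity)
      (pow_lt_one₀ (abs_nonneg ρ) hρ two_ne_zero) (pow_le_one₀ (abs_nonneg q) hq.le)
  linarith [(abs_lt.mp h).2]

lemma qPoch_sq_pos {q ρ : ℝ} (hq : |q| < 1) (hρ : |ρ| < 1) (n : ℕ) : 0 < qPoch (ρ ^ 2) q n :=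
  Finset.prod_pos fun k _ ↦ one_sub_sq_mul_pow_pos hq hρ k

lemma qPoch_succ (a q : ℝ) (n : ℕ) : qPoch a q (n + 1) = qPoch a q n * (1 - a * q ^ n) :=
  Finset.prod_range_succ _ _

lemma qPoch_mul_gammaPM_zero {q ρ x y : ℝ} (hq : |q| < 1) (hρ : |ρ| < 1) (hx : x ∈ Sq q)
    (hy : y ∈ Sq q) (i : ℕ) :
    qPoch (ρ ^ 2) q i * gammaPM q ρ i 0 x y = ascP q y ρ i x * gammaPM q ρ 0 0 x y := by
  have hr := gammaPM_succ_zero hq hρ hx hy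
  have main : ∀ i, qPoch (ρ ^ 2) q i * gammaPM q ρ i 0 x y =
        ascP q y ρ i x * gammaPM q ρ 0 0 x y ∧
      qPoch (ρ ^ 2) q (i + 1) * gammaPM q ρ (i + 1) 0 x y =
        ascP q y ρ (i + 1) x * gammaPM q ρ 0 0 x y := by
    intro i
    induction i with
    | zero =>
      refine ⟨by simp [qPoch, ascP], ?_⟩
      have := hr 0
      rw [qNat_zero] at this
      rw [qPoch_succ, mul_assoc, this]
      simp [qPoch, ascP]
    | succ i ih =>
      refine ⟨ih.2, ?_⟩
      have h := hr (i + 1)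
      rw [Nat.add_sub_cancel] at h
      have h1 := ih.1
      have h2 := ih.2
      rw [qPoch_succ, mul_assoc, h]
      simp only [ascP]
      rw [qPoch_succ] at h2 ⊢
      linear_combination (x - ρ * y * q ^ (i + 1)) * h2 -
        qNat q (i + 1) * (1 - ρ ^ 2 * q ^ i) * h1
  exact (main i).1

lemma gammaPM_eq_Qpoly_mul {q ρ x y : ℝ} (hq : |q| < 1) (hρ : |ρ| < 1) (hx : x ∈ Sq q)
    (hy : y ∈ Sq q) (i j : ℕ) :
    gammaPM q ρ i j x y = Qpoly q ρ i j x y * gammaPM q ρ 0 0 x y := by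
  rw [eq_sum_antidiagonal_of_recurrence hq ρ y (fun i j ↦ gammaPM q ρ i j x y)
    (gammaPM_succ_right hq hρ hx hy) i j, Qpoly, Finset.sum_mul, Finset.mul_sum,
    Finset.Nat.sum_antidiagonal_eq_sum_range_succ_mk]
  refine Finset.sum_congr rfl fun s hs ↦ ?_
  have hsj : s ≤ j := Nat.lt_succ_iff.mp (Finset.mem_range.mp hs)
  have h1 := (qFact_pos hq (j - s)).ne'
  have h2 := (qFact_pos hq s).ne'
  have h3 := (qPoch_sq_pos hq hρ (i + s)).ne'
  have h4 := eq_div_of_mul_eq h3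
    ((mul_comm _ _).trans (qPoch_mul_gammaPM_zero hq hρ hx hy (i + s)))
  simp only [h4, qBinom, qExpCoeff, if_pos hsj]
  field_simp

/-! ### The Poisson-Mehler formula -/

lemma gammaPM_mul_omegaPM {q ρ x y : ℝ} (hq : |q| < 1) (hρ : |ρ| < 1) (hx : x ∈ Sq q)
    (hy : y ∈ Sq q) :
    gammaPM q ρ 0 0 x y *
        omegaPM (x * Real.sqrt (1 - q) / 2) (y * Real.sqrt (1 - q) / 2) ρ =
      (1 - ρ ^ 2) * (1 - ρ ^ 2 * q) * gammaPM q (ρ * q) 0 0 x y := by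
  have h1 : 0 < 1 - q := by linarith [(abs_lt.mp hq).2]
  have hss : Real.sqrt (1 - q) ^ 2 = 1 - q := Real.sq_sqrt h1.le
  have hω : omegaPM (x * Real.sqrt (1 - q) / 2) (y * Real.sqrt (1 - q) / 2) ρ =
      (1 - ρ ^ 2) ^ 2 - ρ * (1 + ρ ^ 2) * x * y * (1 - q) +
        ρ ^ 2 * (x ^ 2 + y ^ 2) * (1 - q) := by
    rw [omegaPM]
    linear_combination (-(ρ * (1 + ρ ^ 2) * x * y) + ρ ^ 2 * (x ^ 2 + y ^ 2)) * hss
  have hS := fun i j ↦ (summable_gammaPM hq hρ hx hy i j).hasSum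
  have hd : gammaPM q (ρ * q) 0 0 x y =
      gammaPM q ρ 0 0 x y - (1 - q) * ρ * gammaPM q ρ 1 1 x y := by
    have hA : HasSum (fun n : ℕ ↦ ρ ^ n / qFact q n * (1 - q ^ n) * qHermite q n x *
        qHermite q n y) ((1 - q) * ρ * gammaPM q ρ 1 1 x y) := by
      have h := (hS 1 1).mul_left ((1 - q) * ρ)
      refine (hasSum_nat_add_iff' 1).mp ?_
      simp only [Finset.sum_range_one, pow_zero, sub_self, mul_zero, zero_mul, sub_zero]
      refine h.congr_fun fun n ↦ ?_
      have h1 := (qFact_pos hq n).ne'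
      have h2 := (qNat_succ_pos hq n).ne'
      rw [← one_sub_mul_qNat]
      simp only [qFact]
      field_simp
      ring
    refine Eq.trans (tsum_congr fun n ↦ ?_) ((hS 0 0).sub hA).tsum_eq
    rw [mul_pow, add_zero]
    ring
  have e1 := gammaPM_succ_right hq hρ hx hy 1 0
  have e2 := gammaPM_succ_zero hq hρ hx hy 1
  have e3 := gammaPM_succ_zero hq hρ hx hy 0
  simp only [qNat_zero, qNat_one, pow_zero, pow_one, zero_add, Nat.reduceAdd,
    Nat.sub_self] at e1 e2 e3
  rw [hω, hd, e1]
  linear_combination ((1 - q) * ρ * y * (1 - ρ ^ 2 * q) -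
    (1 - q) * ρ ^ 2 * (x - ρ * y * q)) * e3 - (1 - q) * ρ ^ 2 * (1 - ρ ^ 2) * e2

lemma abs_mul_pow_lt_one {q ρ : ℝ} (hq : |q| < 1) (hρ : |ρ| < 1) (n : ℕ) :
    |ρ * q ^ n| < 1 := by
  rw [abs_mul, abs_pow]
  exact mul_lt_one_of_nonneg_of_lt_one_left (abs_nonneg ρ) hρ (pow_le_one₀ (abs_nonneg q) hq.le)

lemma gammaPM_mul_prod_omegaPM {q ρ x y : ℝ} (hq : |q| < 1) (hρ : |ρ| < 1) (hx : x ∈ Sq q)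
    (hy : y ∈ Sq q) (N : ℕ) :
    gammaPM q ρ 0 0 x y * ∏ k ∈ Finset.range N,
        omegaPM (x * Real.sqrt (1 - q) / 2) (y * Real.sqrt (1 - q) / 2) (ρ * q ^ k) =
      qPoch (ρ ^ 2) q (2 * N) * gammaPM q (ρ * q ^ N) 0 0 x y := by
  induction N with
  | zero => simp [qPoch]
  | succ N ih =>
    have h := gammaPM_mul_omegaPM hq (abs_mul_pow_lt_one hq hρ N) hx hy
    rw [Finset.prod_range_succ, ← mul_assoc, ih, mul_assoc, h, mul_add, mul_one, qPoch_succ,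
      qPoch_succ, pow_succ q N, mul_assoc ρ]
    ring

lemma tendsto_gammaPM_mul_pow {q ρ x y : ℝ} (hq : |q| < 1) (hρ : |ρ| < 1) (hx : x ∈ Sq q)
    (hy : y ∈ Sq q) :
    Tendsto (fun N : ℕ ↦ gammaPM q (ρ * q ^ N) 0 0 x y) atTop (𝓝 1) := by
  have h0 : Tendsto (fun N : ℕ ↦ ρ * q ^ N) atTop (𝓝 0) := by
    simpa using (tendsto_pow_atTop_nhds_zero_of_abs_lt_one hq).const_mul ρ
  have h := tendsto_tsum_of_dominated_convergence (𝓕 := atTop)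
    (f := fun (N n : ℕ) ↦ (ρ * q ^ N) ^ n / qFact q n * qHermite q (n + 0) x *
      qHermite q (n + 0) y)
    (g := fun n ↦ 0 ^ n / qFact q n * qHermite q (n + 0) x * qHermite q (n + 0) y)
    (summable_gammaPM hq hρ hx hy 0 0).norm
    (fun n ↦ (((h0.pow n).div_const _).mul_const _).mul_const _)
    (Eventually.of_forall fun N n ↦ by
      simp only [norm_mul, norm_div, norm_pow]
      gcongr
      exact mul_le_of_le_one_right (norm_nonneg ρ) (pow_le_one₀ (norm_nonneg q) hq.le))
  rw [tsum_eq_single 0 (fun n hn ↦ by simp [hn])] at h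
  simpa [gammaPM, qFact, qHermite] using h

lemma multipliable_omegaPM {q : ℝ} (hq : |q| < 1) (ρ x y : ℝ) :
    Multipliable fun k : ℕ ↦ omegaPM x y (ρ * q ^ k) := by
  have hs : ∀ m : ℕ, 0 < m → Summable fun k : ℕ ↦ (q ^ k) ^ m := by
    intro m hm
    simp only [← pow_mul, mul_comm _ m]
    simp only [pow_mul]
    refine summable_geometric_of_abs_lt_one ?_
    rw [abs_pow]
    exact pow_lt_one₀ (abs_nonneg q) hq hm.ne'
  have h : Summable fun k : ℕ ↦ omegaPM x y (ρ * q ^ k) - 1 := by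
    have := ((((hs 1 one_pos).mul_left (-4 * ρ * x * y)).add
      ((hs 2 two_pos).mul_left (ρ ^ 2 * (4 * (x ^ 2 + y ^ 2) - 2)))).add
      ((hs 3 three_pos).mul_left (-4 * ρ ^ 3 * x * y))).add ((hs 4 four_pos).mul_left (ρ ^ 4))
    refine this.congr fun k ↦ ?_
    rw [omegaPM]
    ring
  simpa using Real.multipliable_one_add_of_summable h

lemma summable_mul_pow {q : ℝ} (hq : |q| < 1) (a : ℝ) : Summable fun k : ℕ ↦ -(a * q ^ k) :=
  ((summable_geometric_of_abs_lt_one hq).mul_left a).neg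

lemma tendsto_qPoch {q : ℝ} (hq : |q| < 1) (a : ℝ) :
    Tendsto (qPoch a q) atTop (𝓝 (qPochInf a q)) := by
  have := Real.multipliable_one_add_of_summable (summable_mul_pow hq a)
  simp only [← sub_eq_add_neg] at this
  exact this.tendsto_prod_tprod_nat

lemma qPochInf_sq_ne_zero {q ρ : ℝ} (hq : |q| < 1) (hρ : |ρ| < 1) : qPochInf (ρ ^ 2) q ≠ 0 := by
  have := tprod_one_add_ne_zero_of_summable (f := fun k : ℕ ↦ -(ρ ^ 2 * q ^ k))
    (fun k ↦ by
      rw [← sub_eq_add_neg]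
      exact (one_sub_sq_mul_pow_pos hq hρ k).ne')
    (summable_mul_pow hq _).norm
  simpa only [qPochInf, ← sub_eq_add_neg] using this

lemma gammaPM_mul_tprod_omegaPM {q ρ x y : ℝ} (hq : |q| < 1) (hρ : |ρ| < 1) (hx : x ∈ Sq q)
    (hy : y ∈ Sq q) :
    gammaPM q ρ 0 0 x y * ∏' k : ℕ,
        omegaPM (x * Real.sqrt (1 - q) / 2) (y * Real.sqrt (1 - q) / 2) (ρ * q ^ k) =
      qPochInf (ρ ^ 2) q := by
  have h1 := ((multipliable_omegaPM hq ρ (x * Real.sqrt (1 - q) / 2)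
    (y * Real.sqrt (1 - q) / 2)).tendsto_prod_tprod_nat).const_mul (gammaPM q ρ 0 0 x y)
  have h2 := ((tendsto_qPoch hq (ρ ^ 2)).comp
    (tendsto_id.const_mul_atTop' two_pos)).mul (tendsto_gammaPM_mul_pow hq hρ hx hy)
  rw [mul_one] at h2
  refine tendsto_nhds_unique h1 (h2.congr fun N ↦ ?_)
  exact (gammaPM_mul_prod_omegaPM hq hρ hx hy N).symm

/-! ### Inversion of the series -/

lemma abs_qExpCoeff_le {q : ℝ} (hq : |q| < 1) (k : ℕ) : |qExpCoeff q k| ≤ 1 / qFact q k := by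
  have h := qFact_pos hq k
  rw [qExpCoeff, abs_div, abs_mul, abs_pow, abs_pow, abs_neg, abs_one, one_pow, one_mul,
    abs_of_pos h]
  gcongr
  exact pow_le_one₀ (abs_nonneg q) hq.le

lemma summable_double {q ρ x y : ℝ} (hq : |q| < 1) (hρ : |ρ| < 1) (hx : x ∈ Sq q)
    (hy : y ∈ Sq q) :
    Summable fun p : ℕ × ℕ ↦ qExpCoeff q p.1 * ρ ^ p.1 *
      (ρ ^ p.2 / qFact q p.2 * qHermite q (p.2 + p.1) x * qHermite q (p.2 + p.1) y) := by
  have h1 : 0 < 1 - q := by linarith [(abs_lt.mp hq).2]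
  have hs : 0 < Real.sqrt (1 - q) := Real.sqrt_pos.mpr h1
  have hss : Real.sqrt (1 - q) ^ 2 = 1 - q := Real.sq_sqrt h1.le
  obtain ⟨K, hK0, hK⟩ := exists_abs_qHermite_mul_le hq hx hy
  obtain ⟨D, hD⟩ := exists_inv_qFact_le hq
  have hS := summable_succ_sq_mul_pow hρ
  refine Summable.of_norm_bounded (g := fun p : ℕ × ℕ ↦ D * D * K *
    (((p.1 : ℝ) + 1) ^ 2 * |ρ| ^ p.1 * (((p.2 : ℝ) + 1) ^ 2 * |ρ| ^ p.2)))
    ((hS.mul_of_nonneg hS (fun _ ↦ by positivity) (fun _ ↦ by positivity)).mul_left _) ?_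
  rintro ⟨k, n⟩
  have hn := qFact_pos hq n
  have hD0 : ∀ n, 0 ≤ D * (1 - q) ^ n := fun n ↦
    (one_div_pos.mpr (qFact_pos hq n)).le.trans (hD n)
  have hD1 : 0 ≤ D := by simpa using hD0 0
  calc _ = |qExpCoeff q k| * |ρ| ^ k * (|ρ| ^ n * (1 / qFact q n) *
          |qHermite q (n + k) x * qHermite q (n + k) y|) := by
        simp only [Real.norm_eq_abs, abs_mul, abs_div, abs_pow, abs_of_pos hn]; ring
    _ ≤ (D * (1 - q) ^ k) * |ρ| ^ k * (|ρ| ^ n * (D * (1 - q) ^ n) *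
        (K * (((n + k : ℕ) + 1) * ((n + k : ℕ) + 1)) /
          Real.sqrt (1 - q) ^ (n + k + (n + k)))) := by
        gcongr
        · exact (abs_qExpCoeff_le hq k).trans (hD k)
        · exact hD n
        · exact hK _ _
    _ = D * D * K * (((n + k + 1) * (n + k + 1)) * |ρ| ^ k * |ρ| ^ n) := by
        have : Real.sqrt (1 - q) ^ (n + k + (n + k)) = (1 - q) ^ n * (1 - q) ^ k := by
          rw [← two_mul, pow_mul, hss, pow_add]
        rw [this]
        push_cast
        field_simp
    _ ≤ D * D * K * ((((n + 1) * (k + 1)) * ((n + 1) * (k + 1))) * |ρ| ^ k * |ρ| ^ n) := by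
        have : (n + k + 1 : ℝ) ≤ (n + 1) * (k + 1) := by
          nlinarith [mul_nonneg (n.cast_nonneg (α := ℝ)) (k.cast_nonneg (α := ℝ))]
        gcongr
    _ = _ := by ring

lemma hasSum_qExpCoeff_mul_gammaPM {q ρ x y : ℝ} (hq : |q| < 1) (hρ : |ρ| < 1)
    (hx : x ∈ Sq q) (hy : y ∈ Sq q) :
    HasSum (fun k : ℕ ↦ qExpCoeff q k * ρ ^ k * gammaPM q ρ k k x y) 1 := by
  have hS := summable_double hq hρ hx hy
  have hrow := hS.hasSum.prod_fiberwise fun k ↦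
    ((summable_gammaPM hq hρ hx hy k k).hasSum).mul_left (qExpCoeff q k * ρ ^ k)
  convert hrow using 1
  · rfl
  have hdiag : ∀ m : ℕ, (∑' p : antidiagonal m, qExpCoeff q p.1.1 * ρ ^ p.1.1 *
      (ρ ^ p.1.2 / qFact q p.1.2 * qHermite q (p.1.2 + p.1.1) x *
        qHermite q (p.1.2 + p.1.1) y)) =
      ρ ^ m * qHermite q m x * qHermite q m y *
        ∑ p ∈ antidiagonal m, qExpCoeff q p.1 / qFact q p.2 := by
    intro m
    rw [tsum_fintype, Finset.sum_coe_sort (antidiagonal m) (fun p ↦ qExpCoeff q p.1 * ρ ^ p.1 *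
      (ρ ^ p.2 / qFact q p.2 * qHermite q (p.2 + p.1) x * qHermite q (p.2 + p.1) y)),
      Finset.mul_sum]
    refine Finset.sum_congr rfl fun p hp ↦ ?_
    rw [← mem_antidiagonal.mp hp, add_comm p.2 p.1, pow_add]
    ring
  refine Eq.symm (((Finset.HasAntidiagonal.sigmaAntidiagonalEquivProd.tsum_eq _).symm.trans
    (Summable.tsum_sigma' (fun m ↦ (hasSum_fintype _).summable)
      (Finset.HasAntidiagonal.sigmaAntidiagonalEquivProd.summable_iff.mpr hS))).trans
    ((tsum_congr hdiag).trans ?_))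
  rw [tsum_eq_single 0]
  · simp [qExpCoeff, qFact, qHermite]
  · intro m hm
    obtain ⟨n, rfl⟩ := Nat.exists_eq_succ_of_ne_zero hm
    rw [sum_antidiagonal_qExpCoeff hq, mul_zero]

/-- 1/Σ_{n≥0}(ρ^n/[n]_q!)H_n(x|q)H_n(y|q) = ∏_{k≥0} ω(.,.|ρq^k)/(ρ²;q)_∞
= Σ_{k≥0} (-1)^k q^{k(k-1)/2} (ρ^k/[k]_q!) Q_{k,k}(x,y|ρ,q), the series converging. -/
theorem statement14 (q ρ x y : ℝ) (hq : |q| < 1) (hρ : |ρ| < 1)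
    (hx : x ∈ Sq q) (hy : y ∈ Sq q) :
    1 / (∑' n : ℕ, ρ ^ n / qFact q n * qHermite q n x * qHermite q n y) =
        (∏' k : ℕ,
          omegaPM (x * Real.sqrt (1 - q) / 2) (y * Real.sqrt (1 - q) / 2) (ρ * q ^ k)) /
          qPochInf (ρ ^ 2) q ∧
      HasSum
        (fun k : ℕ => (-1 : ℝ) ^ k * q ^ (k * (k - 1) / 2) * ρ ^ k / qFact q k *
          Qpoly q ρ k k x y)
        ((∏' k : ℕ,
          omegaPM (x * Real.sqrt (1 - q) / 2) (y * Real.sqrt (1 - q) / 2) (ρ * q ^ k)) /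
          qPochInf (ρ ^ 2) q) := by
  have hprod := gammaPM_mul_tprod_omegaPM hq hρ hx hy
  have hne : gammaPM q ρ 0 0 x y ≠ 0 := fun h ↦
    qPochInf_sq_ne_zero hq hρ (by rw [← hprod, h, zero_mul])
  have hinv : 1 / gammaPM q ρ 0 0 x y = (∏' k : ℕ,
      omegaPM (x * Real.sqrt (1 - q) / 2) (y * Real.sqrt (1 - q) / 2) (ρ * q ^ k)) /
        qPochInf (ρ ^ 2) q := by
    rw [div_eq_div_iff hne (qPochInf_sq_ne_zero hq hρ), ← hprod]
    ring
  refine ⟨hinv, ?_⟩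
  rw [← hinv]
  refine ((hasSum_qExpCoeff_mul_gammaPM hq hρ hx hy).div_const _).congr_fun fun k ↦ ?_
  rw [gammaPM_eq_Qpoly_mul hq hρ hx hy k k, qExpCoeff, ← mul_assoc, mul_div_cancel_right₀ _ hne]
  ring
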